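/- Let n ≥ 3 and l ≥ 1 be integers, p ∈ (1, n/(2l)) and n(1−p) < β < n − 2lp. Then for every f ∈ C_c^∞(ℝ^n), ∫_{ℝ^n} |f(x)|^p / |x|^{2lp+β} dx ≤ c(n,2l,β,p) ∫_{ℝ^n} |Δ_r^l f(x)|^p / |x|^β dx. -/

import Mathlib

open MeasureTheory

/-- The radial derivative `∂_r f (x) = ⟨x/|x|, ∇f(x)⟩` of `f : ℝⁿ → ℝ`. -/
noncomputable def radDeriv {n : ℕ} (f : EuclideanSpace ℝ (Fin n) → ℝ)
    (x : EuclideanSpace ℝ (Fin n)) : ℝ :=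
  fderiv ℝ f x (‖x‖⁻¹ • x)

/-- The radial Laplacian `Δ_r f = ∂_r² f + ((n-1)/|x|) ∂_r f`. -/
noncomputable def radLap {n : ℕ} (f : EuclideanSpace ℝ (Fin n) → ℝ)
    (x : EuclideanSpace ℝ (Fin n)) : ℝ :=
  radDeriv (radDeriv f) x + ((n : ℝ) - 1) / ‖x‖ * radDeriv f x

/-- The Rellich constant `c(n, 2l, β, p)` of the paper. -/
noncomputable def rellichConst (n l : ℕ) (β p : ℝ) : ℝ :=
  (∏ i ∈ Finset.range l,
      p ^ 2 / (((n : ℝ) - 2 * p - β - 2 * i * p) * ((n : ℝ) * (p - 1) + β + 2 * i * p))) ^ p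


namespace RellichAux
variable {n : ℕ}

/-- `r ∂_r F + a F`. -/
noncomputable def eul (a : ℝ) (F : EuclideanSpace ℝ (Fin n) → ℝ)
    (x : EuclideanSpace ℝ (Fin n)) : ℝ :=
  fderiv ℝ F x x + a * F x

noncomputable def wN (p σ : ℝ) (F : EuclideanSpace ℝ (Fin n) → ℝ) : ENNReal :=
  ∫⁻ x, ‖F x‖ₑ ^ p * ENNReal.ofReal (‖x‖ ^ (-σ))

lemma eul_contDiff (a : ℝ) {F : EuclideanSpace ℝ (Fin n) → ℝ} (hF : ContDiff ℝ (⊤ : ℕ∞) F) :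
    ContDiff ℝ (⊤ : ℕ∞) (eul a F) := by
  have h1 : ContDiff ℝ (⊤ : ℕ∞) (fderiv ℝ F) := hF.fderiv_right (by simp)
  exact (h1.clm_apply contDiff_id).add (contDiff_const.mul hF)

lemma eul_compact (a : ℝ) {F : EuclideanSpace ℝ (Fin n) → ℝ} (hF : HasCompactSupport F) :
    HasCompactSupport (eul a F) := by
  refine hF.mono' ?_
  intro x hx
  by_contra h
  apply hx
  have h1 : fderiv ℝ F x = 0 := by
    by_contra h2
    exact h (support_fderiv_subset ℝ h2)
  have h2 : F x = 0 := image_eq_zero_of_notMem_tsupport h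
  simp [eul, h1, h2]

lemma scaling (p σ : ℝ) (G : EuclideanSpace ℝ (Fin n) → ℝ)
    (hG : Continuous G) {t : ℝ} (ht : 0 < t) :
    ∫⁻ x, ‖G (t • x)‖ₑ ^ p * ENNReal.ofReal (‖x‖ ^ (-σ)) =
      ENNReal.ofReal (t ^ (σ - n)) * wN p σ G := by
  have hm : Measurable fun x : EuclideanSpace ℝ (Fin n) =>
      ‖G x‖ₑ ^ p * ENNReal.ofReal (‖x‖ ^ (-σ)) := by
    have := hG.measurable
    fun_prop
  have key : ∀ x : EuclideanSpace ℝ (Fin n),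
      ‖G (t • x)‖ₑ ^ p * ENNReal.ofReal (‖x‖ ^ (-σ)) = ENNReal.ofReal (t ^ σ) *
        (‖G (t • x)‖ₑ ^ p * ENNReal.ofReal (‖t • x‖ ^ (-σ))) := by
    intro x
    rw [norm_smul, Real.norm_of_nonneg ht.le, Real.mul_rpow ht.le (norm_nonneg _),
      ENNReal.ofReal_mul (by positivity), Real.rpow_neg ht.le, mul_left_comm, ← mul_assoc (ENNReal.ofReal (t ^ σ)),
      ← ENNReal.ofReal_mul (by positivity), mul_inv_cancel₀ (by positivity)]
    simp
  simp_rw [key]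
  rw [lintegral_const_mul _ (by exact hm.comp (measurable_const_smul t)),
    ← lintegral_map (f := fun x => ‖G x‖ₑ ^ p * ENNReal.ofReal (‖x‖ ^ (-σ))) hm (measurable_const_smul t),
    Measure.map_addHaar_smul _ ht.ne', lintegral_smul_measure, smul_eq_mul, ← mul_assoc,
    ← ENNReal.ofReal_mul (by positivity), wN]
  congr 2
  rw [abs_of_pos (by positivity), Real.rpow_sub ht, div_eq_mul_inv]
  simp

lemma holder_step {p a w : ℝ} (hp : 1 < p) (S : Set ℝ) (hS : MeasurableSet S) (hS0 : S ⊆ Set.Ioi 0)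
    (g : ℝ → ENNReal) (hg : Measurable g) :
    (∫⁻ t in S, ENNReal.ofReal (t ^ (a - 1)) * g t) ^ p ≤
      (∫⁻ t in S, ENNReal.ofReal (t ^ (a - 1 - w))) ^ (p - 1) *
      ∫⁻ t in S, ENNReal.ofReal (t ^ (a - 1 + w * (p - 1))) * g t ^ p := by
  have hp0 : 0 < p := by linarith
  set q := p / (p - 1) with hq
  have hpq : q.HolderConjugate p := (Real.HolderConjugate.conjExponent hp).symm
  have hq0 : 0 < q := hpq.pos
  have h := ENNReal.lintegral_mul_le_Lp_mul_Lq (volume.restrict S) hpq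
    (f := fun t => ENNReal.ofReal (t ^ ((a - 1 - w) / q)))
    (g := fun t => ENNReal.ofReal (t ^ ((a - 1 + w * (p - 1)) / p)) * g t)
    (by fun_prop) (by fun_prop)
  have e1 : ∫⁻ t in S, ((fun t => ENNReal.ofReal (t ^ ((a - 1 - w) / q))) *
      (fun t => ENNReal.ofReal (t ^ ((a - 1 + w * (p - 1)) / p)) * g t)) t =
      ∫⁻ t in S, ENNReal.ofReal (t ^ (a - 1)) * g t := by
    refine setLIntegral_congr_fun hS fun t ht => ?_
    have ht0 : 0 < t := hS0 ht
    simp only [Pi.mul_apply]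
    rw [← mul_assoc, ← ENNReal.ofReal_mul (by positivity), ← Real.rpow_add ht0]
    congr 3
    rw [hq]
    have : p - 1 ≠ 0 := by linarith
    field_simp
    ring
  have e2 : ∫⁻ t in S, (fun t => ENNReal.ofReal (t ^ ((a - 1 - w) / q))) t ^ q =
      ∫⁻ t in S, ENNReal.ofReal (t ^ (a - 1 - w)) := by
    refine setLIntegral_congr_fun hS fun t ht => ?_
    have ht0 : 0 < t := hS0 ht
    simp only
    rw [ENNReal.ofReal_rpow_of_nonneg (by positivity) hq0.le, ← Real.rpow_mul ht0.le,
      div_mul_cancel₀ _ hq0.ne']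
  have e3 : ∫⁻ t in S, (fun t => ENNReal.ofReal (t ^ ((a - 1 + w * (p - 1)) / p)) * g t) t ^ p =
      ∫⁻ t in S, ENNReal.ofReal (t ^ (a - 1 + w * (p - 1))) * g t ^ p := by
    refine setLIntegral_congr_fun hS fun t ht => ?_
    have ht0 : 0 < t := hS0 ht
    simp only
    rw [ENNReal.mul_rpow_of_nonneg _ _ hp0.le, ENNReal.ofReal_rpow_of_nonneg (by positivity) hp0.le,
      ← Real.rpow_mul ht0.le, div_mul_cancel₀ _ hp0.ne']
  rw [e1, e2, e3] at h
  refine (ENNReal.rpow_le_rpow h hp0.le).trans_eq ?_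
  rw [ENNReal.mul_rpow_of_nonneg _ _ hp0.le, ← ENNReal.rpow_mul, ← ENNReal.rpow_mul]
  have h1 : 1 / q * p = p - 1 := by
    rw [hq]
    field_simp
  have h2 : 1 / p * p = 1 := by field_simp
  rw [h1, h2, ENNReal.rpow_one]

lemma ae_ne_zero (hn : 0 < n) : ∀ᵐ x : EuclideanSpace ℝ (Fin n), x ≠ 0 := by
  have : Nonempty (Fin n) := ⟨⟨0, hn⟩⟩
  exact Measure.ae_ne volume 0

lemma hardy {p σ a : ℝ} (hn : 0 < n) (hp : 1 < p) (S : Set ℝ) (hS : MeasurableSet S)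
    (hS0 : S ⊆ Set.Ioi 0) (F G : EuclideanSpace ℝ (Fin n) → ℝ) (hG : Continuous G)
    (hF : ∀ x ≠ 0, ‖F x‖ₑ ≤ ∫⁻ t in S, ENNReal.ofReal (t ^ (a - 1)) * ‖G (t • x)‖ₑ) :
    wN p σ F ≤ (∫⁻ t in S, ENNReal.ofReal (t ^ (a - 1 - (n - σ) / p))) ^ p * wN p σ G := by
  have hp0 : 0 < p := by linarith
  set w := ((n : ℝ) - σ) / p with hw
  set A := ∫⁻ t in S, ENNReal.ofReal (t ^ (a - 1 - w)) with hA
  have hGm := hG.measurable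
  calc wN p σ F ≤ ∫⁻ x : EuclideanSpace ℝ (Fin n), A ^ (p - 1) * ∫⁻ t in S, ENNReal.ofReal (t ^ (a - 1 + w * (p - 1))) *
        (‖G (t • x)‖ₑ ^ p * ENNReal.ofReal (‖x‖ ^ (-σ))) := by
        apply lintegral_mono_ae
        filter_upwards [ae_ne_zero hn] with x hx
        have h1 := (ENNReal.rpow_le_rpow (hF x hx) hp0.le).trans
          (holder_step (w := w) hp S hS hS0 (fun t => ‖G (t • x)‖ₑ) (by fun_prop))
        refine (mul_le_mul_left h1 _).trans_eq ?_
        rw [mul_assoc, ← lintegral_mul_const _ (by fun_prop)]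
        simp_rw [mul_assoc]
        rfl
    _ = A ^ (p - 1) * ∫⁻ t in S, ∫⁻ x : EuclideanSpace ℝ (Fin n), ENNReal.ofReal (t ^ (a - 1 + w * (p - 1))) *
        (‖G (t • x)‖ₑ ^ p * ENNReal.ofReal (‖x‖ ^ (-σ))) := by
        have hm : Measurable (Function.uncurry fun (x : EuclideanSpace ℝ (Fin n)) (t : ℝ) => ENNReal.ofReal (t ^ (a - 1 + w * (p - 1))) *
            (‖G (t • x)‖ₑ ^ p * ENNReal.ofReal (‖x‖ ^ (-σ)))) := by
          have : Measurable fun z : EuclideanSpace ℝ (Fin n) × ℝ => G (z.2 • z.1) :=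
            (hG.comp (by fun_prop)).measurable
          unfold Function.uncurry
          fun_prop
        rw [lintegral_const_mul _ (by exact hm.lintegral_prod_right'), lintegral_lintegral_swap hm.aemeasurable]
    _ = A ^ (p - 1) * ∫⁻ t in S, ENNReal.ofReal (t ^ (a - 1 - w)) * wN p σ G := by
        congr 1
        refine setLIntegral_congr_fun hS fun t ht => ?_
        have ht0 : 0 < t := hS0 ht
        rw [lintegral_const_mul _ (by fun_prop), scaling p σ G hG ht0, ← mul_assoc,
          ← ENNReal.ofReal_mul (by positivity), ← Real.rpow_add ht0]
        congr 3
        rw [hw]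
        field_simp
        ring
    _ = A ^ p * wN p σ G := by
        rw [lintegral_mul_const _ (by fun_prop), ← mul_assoc, ← hA]
        congr 1
        nth_rw 2 [← ENNReal.rpow_one A]
        rw [← ENNReal.rpow_add_of_nonneg _ _ (by linarith) (by norm_num)]
        simp

lemma ftc (a : ℝ) {F : EuclideanSpace ℝ (Fin n) → ℝ} (hF : ContDiff ℝ (⊤ : ℕ∞) F)
    (x : EuclideanSpace ℝ (Fin n)) {s t : ℝ} (hs : 0 < s) (hst : s ≤ t) :
    ‖t ^ a * F (t • x) - s ^ a * F (s • x)‖ₑ ≤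
      ∫⁻ τ in Set.Ioc s t, ENNReal.ofReal (τ ^ (a - 1)) * ‖eul a F (τ • x)‖ₑ := by
  have hc := (eul_contDiff a hF).continuous
  have hd : ∀ τ ∈ Set.uIcc s t, HasDerivAt (fun τ => τ ^ a * F (τ • x))
      (τ ^ (a - 1) * eul a F (τ • x)) τ := by
    intro τ hτ
    rw [Set.uIcc_of_le hst] at hτ
    have hτ0 : 0 < τ := hs.trans_le hτ.1
    have h1 := Real.hasDerivAt_rpow_const (p := a) (Or.inl hτ0.ne')
    have h2 : HasDerivAt (fun τ : ℝ => τ • x) x τ := by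
      simpa using (hasDerivAt_id τ).smul_const x
    have h3 := ((hF.differentiable (by simp)) (τ • x)).hasFDerivAt.comp_hasDerivAt τ h2
    refine (h1.mul h3).congr_deriv ?_
    simp only [eul, map_smul, smul_eq_mul, Function.comp]
    have : τ ^ a = τ ^ (a - 1) * τ := by
      rw [Real.rpow_sub_one hτ0.ne']; field_simp
    rw [this]; ring
  have hcont : ContinuousOn (fun τ => τ ^ (a - 1) * eul a F (τ • x)) (Set.uIcc s t) := by
    rw [Set.uIcc_of_le hst]
    refine ContinuousOn.mul ?_ (by fun_prop)
    intro τ hτ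
    exact (Real.continuousAt_rpow_const _ _ (Or.inl (hs.trans_le hτ.1).ne')).continuousWithinAt
  have h := intervalIntegral.integral_eq_sub_of_hasDerivAt hd hcont.intervalIntegrable
  rw [← h, intervalIntegral.integral_of_le hst]
  refine (enorm_integral_le_lintegral_enorm _).trans_eq ?_
  refine setLIntegral_congr_fun measurableSet_Ioc fun τ hτ => ?_
  have hτ0 : 0 < τ := hs.trans hτ.1
  simp only [enorm_mul]
  rw [Real.enorm_of_nonneg (by positivity)]

lemma hardy_infty {p σ a : ℝ} (hn : 0 < n) (hp : 1 < p) {F : EuclideanSpace ℝ (Fin n) → ℝ}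
    (hF : ContDiff ℝ (⊤ : ℕ∞) F) (hFc : HasCompactSupport F) (ha : a - (n - σ) / p < 0) :
    wN p σ F ≤ ENNReal.ofReal ((n - σ) / p - a)⁻¹ ^ p * wN p σ (eul a F) := by
  have h := hardy (σ := σ) (a := a) hn hp (Set.Ioi 1) measurableSet_Ioi
    (Set.Ioi_subset_Ioi zero_le_one) F (eul a F) (eul_contDiff a hF).continuous ?_
  · rw [← ofReal_integral_eq_lintegral_ofReal
      (integrableOn_Ioi_rpow_of_lt (by linarith) one_pos), integral_Ioi_rpow_of_lt (by linarith) one_pos] at h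
    · refine h.trans_eq ?_
      congr 3
      rw [Real.one_rpow, neg_div, one_div, ← inv_neg]
      congr 1
      ring
    · filter_upwards [ae_restrict_mem measurableSet_Ioi] with t ht
      exact Real.rpow_nonneg (zero_le_one.trans (le_of_lt ht)) _
  · intro x hx
    obtain ⟨R, hR⟩ := hFc.isBounded.subset_closedBall (0 : EuclideanSpace ℝ (Fin n))
    have hxn : 0 < ‖x‖ := norm_pos_iff.2 hx
    obtain ⟨T, hT1, hT2⟩ : ∃ T : ℝ, 1 ≤ T ∧ R < T * ‖x‖ := by
      refine ⟨max 1 ((|R| + 1) / ‖x‖), le_max_left _ _, ?_⟩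
      calc R < |R| + 1 := by linarith [le_abs_self R]
        _ = (|R| + 1) / ‖x‖ * ‖x‖ := by field_simp
        _ ≤ _ := by gcongr; exact le_max_right _ _
    have h0 : F (T • x) = 0 := by
      apply image_eq_zero_of_notMem_tsupport
      intro h
      have := hR h
      rw [mem_closedBall_zero_iff, norm_smul, Real.norm_of_nonneg (by linarith)] at this
      linarith
    have h1 := ftc a hF x one_pos hT1
    simp only [h0, mul_zero, zero_sub, enorm_neg, Real.one_rpow, one_mul, one_smul] at h1
    exact h1.trans (lintegral_mono_set Set.Ioc_subset_Ioi_self)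

lemma hardy_zero {p σ a : ℝ} (hn : 0 < n) (hp : 1 < p) {F : EuclideanSpace ℝ (Fin n) → ℝ}
    (hF : ContDiff ℝ (⊤ : ℕ∞) F) (ha0 : 0 < a) (ha : 0 < a - (n - σ) / p) :
    wN p σ F ≤ ENNReal.ofReal (a - (n - σ) / p)⁻¹ ^ p * wN p σ (eul a F) := by
  have h := hardy (σ := σ) (a := a) hn hp (Set.Ioc 0 1) measurableSet_Ioc
    Set.Ioc_subset_Ioi_self F (eul a F) (eul_contDiff a hF).continuous ?_
  · have hi : IntervalIntegrable (fun t : ℝ => t ^ (a - 1 - (n - σ) / p)) volume 0 1 :=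
      intervalIntegral.intervalIntegrable_rpow' (by linarith)
    rw [← ofReal_integral_eq_lintegral_ofReal
      ((intervalIntegrable_iff_integrableOn_Ioc_of_le zero_le_one).1 hi),
      ← intervalIntegral.integral_of_le zero_le_one, integral_rpow (Or.inl (by linarith))] at h
    · refine h.trans_eq ?_
      congr 3
      rw [Real.one_rpow, Real.zero_rpow (by linarith)]
      rw [sub_zero, one_div]
      congr 1
      ring
    · filter_upwards [ae_restrict_mem measurableSet_Ioc] with t ht
      exact Real.rpow_nonneg ht.1.le _
  · intro x hx
    have hlim : Filter.Tendsto (fun s : ℝ => ‖F x - s ^ a * F (s • x)‖ₑ) (nhdsWithin 0 (Set.Ioi 0))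
        (nhds ‖F x‖ₑ) := by
      have hc : Continuous fun s : ℝ => ‖F x - s ^ a * F (s • x)‖ₑ := by
        have h1 : Continuous fun s : ℝ => s ^ a := Real.continuous_rpow_const ha0.le
        have h2 := hF.continuous
        fun_prop
      have := hc.tendsto 0
      simp only [Real.zero_rpow ha0.ne', zero_mul, sub_zero] at this
      exact this.mono_left nhdsWithin_le_nhds
    refine le_of_tendsto hlim ?_
    filter_upwards [Ioo_mem_nhdsGT (one_pos : (0 : ℝ) < 1)] with s hs
    have h1 := ftc a hF x hs.1 hs.2.le
    simp only [Real.one_rpow, one_mul, one_smul] at h1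
    exact h1.trans (lintegral_mono_set (Set.Ioc_subset_Ioc_left hs.1.le))

lemma radDeriv_eq (m : ℤ) {F g : EuclideanSpace ℝ (Fin n) → ℝ} (hF : ContDiff ℝ (⊤ : ℕ∞) F)
    (hg : ∀ x ≠ 0, g x = ‖x‖ ^ m * F x) (x : EuclideanSpace ℝ (Fin n)) (hx : x ≠ 0) :
    radDeriv g x = ‖x‖ ^ (m - 1) * eul m F x := by
  have hxn : ‖x‖ ≠ 0 := norm_ne_zero_iff.2 hx
  have hev : g =ᶠ[nhds x] fun y => ‖y‖ ^ m * F y := by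
    filter_upwards [isOpen_ne.mem_nhds hx] with y hy using hg y hy
  have hFd : Differentiable ℝ F := hF.differentiable (by simp)
  have hd : DifferentiableAt ℝ (fun y => ‖y‖ ^ m * F y) x := by
    refine DifferentiableAt.mul ?_ (hFd x)
    exact (differentiableAt_id.norm ℝ hx).zpow (Or.inl hxn)
  have h2 : HasDerivAt (fun τ : ℝ => τ • x) x 1 := by
    simpa using (hasDerivAt_id (1 : ℝ)).smul_const x
  have hd1 : HasFDerivAt (fun y => ‖y‖ ^ m * F y) (fderiv ℝ (fun y => ‖y‖ ^ m * F y) x)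
      ((1 : ℝ) • x) := by
    rw [one_smul]; exact hd.hasFDerivAt
  have h3 := hd1.comp_hasDerivAt (1 : ℝ) h2
  have hF1 : HasFDerivAt F (fderiv ℝ F x) ((1 : ℝ) • x) := by
    rw [one_smul]; exact (hFd x).hasFDerivAt
  have h4 := hF1.comp_hasDerivAt (1 : ℝ) h2
  have h5 := ((hasDerivAt_zpow m (1 : ℝ) (Or.inl one_ne_zero)).mul h4).const_mul (‖x‖ ^ m)
  have h6 : ((fun y => ‖y‖ ^ m * F y) ∘ fun τ : ℝ => τ • x) =ᶠ[nhds 1]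
      fun τ => ‖x‖ ^ m * (((fun τ : ℝ => τ ^ m) * (F ∘ fun τ : ℝ => τ • x)) τ) := by
    filter_upwards [isOpen_Ioi.mem_nhds (show (0 : ℝ) < 1 from one_pos)] with τ hτ
    have hτ0 : 0 < τ := hτ
    simp only [Function.comp, Pi.mul_apply, norm_smul, Real.norm_of_nonneg hτ0.le, mul_zpow]
    ring
  have h7 := h3.unique (h5.congr_of_eventuallyEq h6)
  unfold radDeriv eul
  rw [hev.fderiv_eq, map_smul, h7, zpow_sub_one₀ hxn]
  simp
  ring

lemma radLap_eq (m : ℤ) {F g : EuclideanSpace ℝ (Fin n) → ℝ} (hF : ContDiff ℝ (⊤ : ℕ∞) F)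
    (hg : ∀ x ≠ 0, g x = ‖x‖ ^ m * F x) (x : EuclideanSpace ℝ (Fin n)) (hx : x ≠ 0) :
    radLap g x = ‖x‖ ^ (m - 2) * eul ((n : ℝ) - 2 + m) (eul m F) x := by
  have hxn : ‖x‖ ≠ 0 := norm_ne_zero_iff.2 hx
  have h1 := radDeriv_eq m hF hg
  have h2 := radDeriv_eq (m - 1) (eul_contDiff (m : ℝ) hF) h1 x hx
  rw [radLap, h2, h1 x hx]
  have e : m - 1 - 1 = m - 2 := by ring
  have e2 : ‖x‖ ^ (m - 1) = ‖x‖ ^ (m - 2) * ‖x‖ := by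
    rw [← zpow_add_one₀ hxn]; congr 1; ring
  rw [e, e2]
  unfold eul
  push_cast
  field_simp
  ring

/-- `Δ_r^j f = |x|^{-2j} Fseq f j`. -/
noncomputable def Fseq (f : EuclideanSpace ℝ (Fin n) → ℝ) : ℕ → EuclideanSpace ℝ (Fin n) → ℝ
  | 0 => f
  | j + 1 => eul ((n : ℝ) - 2 + ((-2 * (j : ℤ) : ℤ) : ℝ)) (eul ((-2 * (j : ℤ) : ℤ) : ℝ) (Fseq f j))

lemma Fseq_contDiff {f : EuclideanSpace ℝ (Fin n) → ℝ} (hf : ContDiff ℝ (⊤ : ℕ∞) f) (j : ℕ) :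
    ContDiff ℝ (⊤ : ℕ∞) (Fseq f j) := by
  induction j with
  | zero => exact hf
  | succ j ih => exact eul_contDiff _ (eul_contDiff _ ih)

lemma Fseq_compact {f : EuclideanSpace ℝ (Fin n) → ℝ} (hf : HasCompactSupport f) (j : ℕ) :
    HasCompactSupport (Fseq f j) := by
  induction j with
  | zero => exact hf
  | succ j ih => exact eul_compact _ (eul_compact _ ih)

lemma iterate_eq {f : EuclideanSpace ℝ (Fin n) → ℝ} (hf : ContDiff ℝ (⊤ : ℕ∞) f) (j : ℕ) :
    ∀ x ≠ 0, (radLap^[j] f) x = ‖x‖ ^ (-2 * (j : ℤ)) * Fseq f j x := by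
  induction j with
  | zero => intro x _; simp [Fseq]
  | succ j ih =>
    intro x hx
    rw [Function.iterate_succ_apply', radLap_eq _ (Fseq_contDiff hf j) ih x hx, Fseq]
    congr 2
    push_cast
    ring

lemma wN_lt_top (hn : 0 < n) {p σ : ℝ} (hp : 1 < p) (hσ : σ < n)
    {F : EuclideanSpace ℝ (Fin n) → ℝ} (hF : Continuous F) (hFc : HasCompactSupport F) :
    wN p σ F < ⊤ := by
  have hp0 : 0 < p := by linarith
  obtain ⟨C, hC⟩ := hFc.exists_bound_of_continuous hF
  have hFm := hF.measurable
  have hm : Measurable fun x : EuclideanSpace ℝ (Fin n) => |F x| ^ p * ‖x‖ ^ (-σ) := by fun_prop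
  have hloc : LocallyIntegrable (fun x : EuclideanSpace ℝ (Fin n) => |F x| ^ p * ‖x‖ ^ (-σ)) := by
    refine locallyIntegrable_of_norm_le_rpow (C := C ^ p) (α := σ) (by simpa using Nat.succ_le_of_lt hn)
      (by simpa using hσ) (Filter.Eventually.of_forall fun x => ?_) hm.aestronglyMeasurable
    rw [Real.norm_of_nonneg (by positivity)]
    gcongr
    exact hC x
  have hintg : Integrable (fun x : EuclideanSpace ℝ (Fin n) => |F x| ^ p * ‖x‖ ^ (-σ)) := by
    rw [← integrableOn_iff_integrable_of_support_subset (s := tsupport F)]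
    · exact hloc.integrableOn_isCompact hFc
    · intro x hx
      apply subset_tsupport
      intro h
      apply hx
      simp [h, Real.zero_rpow hp0.ne']
  have := hintg.lintegral_lt_top
  refine lt_of_eq_of_lt ?_ this
  unfold wN
  congr 1
  ext x
  rw [ENNReal.ofReal_mul (by positivity), ← ENNReal.ofReal_rpow_of_nonneg (abs_nonneg _) hp0.le,
    ← Real.norm_eq_abs, ofReal_norm]

lemma wN_toReal {p σ : ℝ} (hp : 1 < p)
    {F : EuclideanSpace ℝ (Fin n) → ℝ} (hF : Continuous F) :
    (wN p σ F).toReal = ∫ x, |F x| ^ p / ‖x‖ ^ σ := by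
  have hp0 : 0 < p := by linarith
  have hFm := hF.measurable
  have hm : Measurable fun x : EuclideanSpace ℝ (Fin n) => |F x| ^ p / ‖x‖ ^ σ := by fun_prop
  rw [integral_eq_lintegral_of_nonneg_ae (Filter.Eventually.of_forall fun x => by
    simp only [Pi.zero_apply]; positivity)
    hm.aestronglyMeasurable]
  unfold wN
  congr 2
  ext x
  rw [div_eq_mul_inv, ← Real.rpow_neg (norm_nonneg _),
    ENNReal.ofReal_mul (by positivity), ← ENNReal.ofReal_rpow_of_nonneg (abs_nonneg _) hp0.le,
    ← Real.norm_eq_abs, ofReal_norm]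

/-- One step constant. -/
noncomputable def cst (n l : ℕ) (β p : ℝ) (j : ℕ) : ℝ :=
  p ^ 2 / (((n : ℝ) - 2 * l * p - β + 2 * j * p) *
    (((n : ℝ) - 2 - 2 * j) * p - n + 2 * l * p + β))

lemma chain {l : ℕ} (hn : 0 < n) {p β : ℝ} (hp : 1 < p)
    (hpl : 2 * l * p < n) (hβl : (n : ℝ) * (1 - p) < β) (hβu : β < n - 2 * l * p)
    {f : EuclideanSpace ℝ (Fin n) → ℝ} (hf : ContDiff ℝ (⊤ : ℕ∞) f) (hfc : HasCompactSupport f)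
    (k : ℕ) (hk : k ≤ l) :
    wN p (2 * l * p + β) f ≤ ENNReal.ofReal ((∏ j ∈ Finset.range k, cst n l β p j) ^ p) *
      wN p (2 * l * p + β) (Fseq f k) := by
  have hp0 : 0 < p := by linarith
  induction k with
  | zero => simp [Fseq]
  | succ j ih =>
    refine (ih (by omega)).trans ?_
    have hjl : (j : ℝ) + 1 ≤ l := by exact_mod_cast hk
    have hj0 : (0 : ℝ) ≤ j := j.cast_nonneg
    have hA : 0 < (n : ℝ) - 2 * l * p - β + 2 * j * p := by
      have : 0 ≤ 2 * (j : ℝ) * p := by positivity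
      linarith
    have hB : ∀ i : ℕ, i < l → 0 < ((n : ℝ) - 2 - 2 * i) * p - n + 2 * l * p + β := by
      intro i hi
      have h1 : (i : ℝ) + 1 ≤ l := by exact_mod_cast hi
      nlinarith
    have hBj := hB j (by omega)
    have hc : ∀ i ∈ Finset.range j, 0 ≤ cst n l β p i := by
      intro i hi
      have hi' := Finset.mem_range.1 hi
      have h1 := hB i (by omega)
      have h2 : 0 ≤ 2 * (i : ℝ) * p := by positivity
      have h3 : 0 < (n : ℝ) - 2 * l * p - β + 2 * i * p := by linarith
      unfold cst
      positivity
    have hs := Fseq_contDiff hf j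
    have h1 := hardy_infty (σ := 2 * l * p + β) (a := ((-2 * (j : ℤ) : ℤ) : ℝ)) hn hp hs
      (Fseq_compact hfc j) (by
        have : (0 : ℝ) < (n - (2 * l * p + β)) / p := div_pos (by linarith) hp0
        push_cast
        linarith)
    have hb : 0 < ((n : ℝ) - 2 + ((-2 * (j : ℤ) : ℤ) : ℝ)) - (n - (2 * l * p + β)) / p := by
      have : ((n : ℝ) - 2 + ((-2 * (j : ℤ) : ℤ) : ℝ)) - (n - (2 * l * p + β)) / p =
          (((n : ℝ) - 2 - 2 * j) * p - n + 2 * l * p + β) / p := by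
        push_cast
        field_simp
        ring
      rw [this]
      positivity
    have h2 := hardy_zero (σ := 2 * l * p + β) (a := (n : ℝ) - 2 + ((-2 * (j : ℤ) : ℤ) : ℝ))
      hn hp (eul_contDiff ((-2 * (j : ℤ) : ℤ) : ℝ) hs) (by push_cast; nlinarith) hb
    have h3 := h1.trans (mul_le_mul_right h2 _)
    refine (mul_le_mul_right h3 _).trans_eq ?_
    rw [Fseq, ← mul_assoc, ← mul_assoc]
    congr 1
    have ha : 0 < ((n : ℝ) - (2 * l * p + β)) / p - ((-2 * (j : ℤ) : ℤ) : ℝ) := by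
      have : (0 : ℝ) < (n - (2 * l * p + β)) / p := div_pos (by linarith) hp0
      push_cast
      linarith
    have hP := Finset.prod_nonneg hc
    rw [ENNReal.ofReal_rpow_of_nonneg (by positivity) hp0.le,
      ENNReal.ofReal_rpow_of_nonneg (by positivity) hp0.le,
      ← ENNReal.ofReal_mul (by positivity), ← ENNReal.ofReal_mul (by positivity),
      ← Real.mul_rpow (by positivity) (by positivity),
      ← Real.mul_rpow (by positivity) (by positivity), Finset.prod_range_succ, mul_assoc]
    congr 3
    have e1 : ((n : ℝ) - (2 * l * p + β)) / p - ((-2 * (j : ℤ) : ℤ) : ℝ) =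
        ((n : ℝ) - 2 * l * p - β + 2 * j * p) / p := by
      push_cast
      field_simp
      ring
    have e2 : ((n : ℝ) - 2 + ((-2 * (j : ℤ) : ℤ) : ℝ)) - (n - (2 * l * p + β)) / p =
        (((n : ℝ) - 2 - 2 * j) * p - n + 2 * l * p + β) / p := by
      push_cast
      field_simp
      ring
    rw [e1, e2, cst, inv_div, inv_div, div_mul_div_comm, sq]

lemma const_eq (n l : ℕ) (β p : ℝ) :
    (∏ j ∈ Finset.range l, cst n l β p j) ^ p = rellichConst n l β p := by
  unfold rellichConst
  congr 1
  rw [← Finset.prod_range_reflect]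
  refine Finset.prod_congr rfl fun i hi => ?_
  have hi' := Finset.mem_range.1 hi
  have : ((l - 1 - i : ℕ) : ℝ) = (l : ℝ) - 1 - i := by
    rw [Nat.cast_sub (by omega), Nat.cast_sub (by omega)]; simp
  unfold cst
  rw [this]
  congr 2 <;> ring

end RellichAux

/-- Euclidean case of the higher-order weighted Rellich inequality, Theorem 4.5 (i). -/
theorem rellich_radial_higher_even (n l : ℕ) (hn : 3 ≤ n) (hl : 1 ≤ l) (p β : ℝ)
    (hp1 : 1 < p) (hpn : p < n / (2 * l)) (hβl : (n : ℝ) * (1 - p) < β)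
    (hβu : β < n - 2 * l * p)
    (f : EuclideanSpace ℝ (Fin n) → ℝ) (hf : ContDiff ℝ (⊤ : ℕ∞) f) (hfc : HasCompactSupport f) :
    ∫ x : EuclideanSpace ℝ (Fin n), |f x| ^ p / ‖x‖ ^ (2 * l * p + β) ≤
      rellichConst n l β p *
        ∫ x : EuclideanSpace ℝ (Fin n), |(radLap^[l] f) x| ^ p / ‖x‖ ^ β := by
  
  have hn0 : 0 < n := by omega
  have hp0 : 0 < p := by linarith
  have hl0 : (0 : ℝ) < l := by exact_mod_cast hl
  have hpl : 2 * l * p < n := by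
    rw [lt_div_iff₀ (by positivity)] at hpn
    linarith
  have hσ : 2 * l * p + β < n := by linarith
  have hs := RellichAux.Fseq_contDiff hf l
  have hsc := RellichAux.Fseq_compact hfc l
  have h := RellichAux.chain hn0 hp1 hpl hβl hβu hf hfc l le_rfl
  have hR : ∫ x : EuclideanSpace ℝ (Fin n), |(radLap^[l] f) x| ^ p / ‖x‖ ^ β =
      ∫ x : EuclideanSpace ℝ (Fin n), |RellichAux.Fseq f l x| ^ p / ‖x‖ ^ (2 * l * p + β) := by
    apply integral_congr_ae
    filter_upwards [RellichAux.ae_ne_zero hn0] with x hx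
    have hxn : 0 < ‖x‖ := norm_pos_iff.2 hx
    rw [RellichAux.iterate_eq hf l x hx, abs_mul, abs_of_pos (by positivity),
      Real.mul_rpow (by positivity) (abs_nonneg _), ← Real.rpow_intCast, ← Real.rpow_mul hxn.le,
      Real.rpow_add hxn]
    have : (((-2 * (l : ℤ) : ℤ) : ℝ)) * p = -(2 * l * p) := by push_cast; ring
    rw [this, Real.rpow_neg hxn.le]
    field_simp
  rw [hR, ← RellichAux.wN_toReal hp1 hf.continuous, ← RellichAux.wN_toReal hp1 hs.continuous]
  rw [RellichAux.const_eq] at h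
  have hfin := RellichAux.wN_lt_top hn0 hp1 hσ hs.continuous hsc
  have h2 := ENNReal.toReal_mono (ENNReal.mul_ne_top ENNReal.ofReal_ne_top hfin.ne) h
  rw [ENNReal.toReal_mul, ENNReal.toReal_ofReal] at h2
  · exact h2
  · unfold rellichConst
    refine Real.rpow_nonneg (Finset.prod_nonneg fun i hi => ?_) _
    have h1 : (i : ℝ) + 1 ≤ l := by exact_mod_cast Finset.mem_range.1 hi
    have hi0 : (0 : ℝ) ≤ 2 * i * p := by positivity
    have h3 : 0 < (n : ℝ) - 2 * p - β - 2 * i * p := by nlinarith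
    have h4 : 0 < (n : ℝ) * (p - 1) + β + 2 * i * p := by nlinarith
    positivity
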